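/- For jointly standard Gaussian X, Y with correlation ρ ∈ [-1,1] and Φ the standard normal CDF, E[Φ(X)Φ(Y)] = 1/4 + ρ/(4π) + O(ρ³) as ρ → 0; concretely, |E[Φ(X)Φ(Y)] - 1/4 - ρ/(4π)| ≤ C|ρ|³ for an absolute constant C. -/

import Mathlib

open MeasureTheory ProbabilityTheory

open Filter Topology
open scoped NNReal

lemma integral_cdf_gaussianReal_comp_affine (s t : ℝ) {v : ℝ≥0} (hv : (v : ℝ) = s ^ 2 + 1) :
    ∫ y, cdf (gaussianReal 0 1) (t + s * y) ∂gaussianReal 0 1 = cdf (gaussianReal 0 v) t := by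
  have hconv : gaussianReal 0 v =
      (gaussianReal 0 1).map (fun y ↦ -s * y) ∗ gaussianReal 0 1 := by
    rw [gaussianReal_map_const_mul, gaussianReal_conv_gaussianReal]
    congr 1
    · simp
    · ext
      simp [hv]
  have hm : Measurable fun y ↦ cdf (gaussianReal 0 1) (t + s * y) :=
    (monotone_cdf _).measurable.comp (by fun_prop)
  rw [integral_eq_lintegral_of_nonneg_ae (ae_of_all _ fun _ ↦ cdf_nonneg _ _)
    hm.aestronglyMeasurable, cdf_eq_real, measureReal_def]
  congr 1
  rw [hconv, ← lintegral_indicator_one measurableSet_Iic,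
    Measure.lintegral_conv (measurable_one.indicator measurableSet_Iic),
    lintegral_map (Measurable.lintegral_prod_right' (f := fun p : ℝ × ℝ ↦
      (Set.Iic t).indicator 1 (p.1 + p.2))
      ((measurable_one.indicator measurableSet_Iic).comp (by fun_prop))) (by fun_prop)]
  refine lintegral_congr fun y ↦ ?_
  rw [ofReal_cdf, ← lintegral_indicator_one measurableSet_Iic]
  refine lintegral_congr fun x ↦ ?_
  simp only [Set.indicator_apply, Set.mem_Iic]
  congr 1
  exact propext ⟨fun h ↦ by linarith, fun h ↦ by linarith⟩

lemma cdf_gaussianReal_eq_integral (v : ℝ≥0) (hv : v ≠ 0) (t : ℝ) :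
    cdf (gaussianReal 0 v) t = ∫ u in Set.Iic t, gaussianPDFReal 0 v u := by
  rw [cdf_eq_real, measureReal_def, gaussianReal_apply_eq_integral 0 hv, ENNReal.toReal_ofReal]
  exact integral_nonneg fun _ ↦ gaussianPDFReal_nonneg _ _ _

lemma cdf_gaussianReal_zero (v : ℝ≥0) (hv : v ≠ 0) : cdf (gaussianReal 0 v) 0 = 1 / 2 := by
  have hneg : ∫ u in Set.Iic 0, gaussianPDFReal 0 v u =
      ∫ u in Set.Ioi 0, gaussianPDFReal 0 v u := by
    have := integral_comp_neg_Iic (0 : ℝ) (gaussianPDFReal 0 v)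
    simpa [gaussianPDFReal] using this
  have hsum := intervalIntegral.integral_Iic_add_Ioi (b := (0 : ℝ)) (μ := volume)
    (integrable_gaussianPDFReal 0 v).integrableOn (integrable_gaussianPDFReal 0 v).integrableOn
  rw [integral_gaussianPDFReal_eq_one 0 hv, ← hneg] at hsum
  rw [cdf_gaussianReal_eq_integral v hv]
  linarith

lemma cdf_gaussianReal_eq_half_add_intervalIntegral (v : ℝ≥0) (hv : v ≠ 0) (t : ℝ) :
    cdf (gaussianReal 0 v) t = 1 / 2 + ∫ u in (0)..t, gaussianPDFReal 0 v u := by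
  rw [← intervalIntegral.integral_Iic_sub_Iic
    (integrable_gaussianPDFReal 0 v).integrableOn (integrable_gaussianPDFReal 0 v).integrableOn,
    ← cdf_gaussianReal_eq_integral v hv, ← cdf_gaussianReal_eq_integral v hv,
    cdf_gaussianReal_zero v hv]
  ring

lemma continuous_gaussianPDFReal_zero (v : ℝ≥0) : Continuous (gaussianPDFReal 0 v) := by
  rw [gaussianPDFReal_def]
  fun_prop

lemma hasDerivAt_cdf_gaussianReal (v : ℝ≥0) (hv : v ≠ 0) (t : ℝ) :
    HasDerivAt (cdf (gaussianReal 0 v)) (gaussianPDFReal 0 v t) t := by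
  have hc := continuous_gaussianPDFReal_zero v
  rw [show (cdf (gaussianReal 0 v) : ℝ → ℝ) = fun t ↦ 1 / 2 + ∫ u in (0)..t, gaussianPDFReal 0 v u
    from funext (cdf_gaussianReal_eq_half_add_intervalIntegral v hv)]
  exact (intervalIntegral.integral_hasDerivAt_right (hc.intervalIntegrable _ _)
    (hc.stronglyMeasurableAtFilter _ _) hc.continuousAt).const_add _

lemma abs_gaussianPDFReal_sub_le (v : ℝ≥0) (hv : 1 ≤ v) (u : ℝ) :
    |gaussianPDFReal 0 v u - (√(2 * Real.pi * v))⁻¹| ≤ u ^ 2 := by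
  have hv' : (1 : ℝ) ≤ v := by exact_mod_cast hv
  have h1 : 1 - u ^ 2 / (2 * v) ≤ Real.exp (-(u ^ 2) / (2 * v)) := by
    have := Real.add_one_le_exp (-(u ^ 2) / (2 * v))
    have e : -(u ^ 2) / (2 * v) = - (u ^ 2 / (2 * (v : ℝ))) := by ring
    linarith
  have h2 : Real.exp (-(u ^ 2) / (2 * v)) ≤ 1 :=
    Real.exp_le_one_iff.2 (div_nonpos_of_nonpos_of_nonneg (by nlinarith [sq_nonneg u])
      (by positivity))
  have h3 : u ^ 2 / (2 * (v : ℝ)) ≤ u ^ 2 := div_le_self (sq_nonneg u) (by linarith)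
  have h4 : 1 ≤ √(2 * Real.pi * v) := Real.one_le_sqrt.2 (by nlinarith [Real.pi_gt_three])
  have h5 : (√(2 * Real.pi * v))⁻¹ ≤ 1 := inv_le_one_of_one_le₀ h4
  have h6 : 0 ≤ (√(2 * Real.pi * v))⁻¹ := by positivity
  rw [gaussianPDFReal, sub_zero, abs_le]
  constructor <;> nlinarith [sq_nonneg u]

lemma abs_cdf_gaussianReal_sub_le (v : ℝ≥0) (hv : 1 ≤ v) (t : ℝ) :
    |cdf (gaussianReal 0 v) t - 1 / 2 - t * (√(2 * Real.pi * v))⁻¹| ≤ |t| ^ 3 := by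
  have hc := continuous_gaussianPDFReal_zero v
  have h : cdf (gaussianReal 0 v) t - 1 / 2 - t * (√(2 * Real.pi * v))⁻¹ =
      ∫ u in (0)..t, (gaussianPDFReal 0 v u - (√(2 * Real.pi * v))⁻¹) := by
    rw [cdf_gaussianReal_eq_half_add_intervalIntegral v (by positivity),
      intervalIntegral.integral_sub (hc.intervalIntegrable _ _) (by simp),
      intervalIntegral.integral_const, smul_eq_mul]
    ring
  rw [h, ← Real.norm_eq_abs]
  refine (intervalIntegral.norm_integral_le_of_norm_le_const (C := |t| ^ 2) fun u hu ↦ ?_).trans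
    (by rw [sub_zero]; exact (pow_succ _ _).ge)
  refine (abs_gaussianPDFReal_sub_le v hv u).trans ?_
  refine (sq_abs u).ge.trans (pow_le_pow_left₀ (abs_nonneg u) ?_ 2)
  rcases Set.mem_uIoc.1 hu with h | h
  · rw [abs_of_pos h.1, abs_of_pos (h.1.trans_le h.2)]; exact h.2
  · rw [abs_of_nonpos h.2, abs_of_neg (h.1.trans_le h.2)]; linarith

lemma hasDerivAt_gaussianPDFReal_std (x : ℝ) :
    HasDerivAt (gaussianPDFReal 0 1) (-x * gaussianPDFReal 0 1 x) x := by
  have h : HasDerivAt (fun x : ℝ ↦ (√(2 * Real.pi * (1 : ℝ≥0)))⁻¹ *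
      Real.exp (-(x - 0) ^ 2 / (2 * (1 : ℝ≥0)))) _ x :=
    ((((((hasDerivAt_id x).sub_const 0).pow 2).neg).div_const _).exp).const_mul _
  convert! h using 1
  simp [gaussianPDFReal]
  ring

lemma tendsto_gaussianPDFReal_std_cocompact :
    Tendsto (gaussianPDFReal 0 1) (cocompact ℝ) (𝓝 0) := by
  have h := (tendsto_rpow_abs_mul_exp_neg_mul_sq_cocompact (a := 1 / 2) (by norm_num) 0).const_mul
    (√(2 * Real.pi * (1 : ℝ≥0)))⁻¹
  rw [mul_zero] at h
  refine h.congr fun x ↦ ?_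
  rw [gaussianPDFReal, Real.rpow_zero, one_mul, NNReal.coe_one]
  congr 2
  ring

lemma integral_mul_cdf_gaussianReal :
    ∫ x, x * cdf (gaussianReal 0 1) x ∂gaussianReal 0 1 = (2 * √Real.pi)⁻¹ := by
  have hcm : Measurable (cdf (gaussianReal 0 1)) := (monotone_cdf _).measurable
  have hint : Integrable (fun x ↦ x * gaussianPDFReal 0 1 x) := by
    have : Integrable (fun x : ℝ ↦ x * Real.exp (-(1 / 2) * x ^ 2)) :=
      integrable_mul_exp_neg_mul_sq (by norm_num)
    refine (this.const_mul ((√(2 * Real.pi * (1 : ℝ≥0)))⁻¹)).congr (ae_of_all _ fun x ↦ ?_)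
    simp [gaussianPDFReal]
    ring_nf
  have hsqe : ∀ x, gaussianPDFReal 0 1 x ^ 2 = (2 * Real.pi)⁻¹ * Real.exp (-1 * x ^ 2) := fun x ↦ by
    rw [gaussianPDFReal, mul_pow, inv_pow, Real.sq_sqrt (by positivity), ← Real.exp_nat_mul]
    simp
    ring_nf
  have hsq : Integrable (fun x ↦ gaussianPDFReal 0 1 x ^ 2) := by
    simp_rw [hsqe]
    exact (integrable_exp_neg_mul_sq one_pos).const_mul _
  have hsqv : ∫ x, gaussianPDFReal 0 1 x ^ 2 = (2 * √Real.pi)⁻¹ := by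
    simp_rw [hsqe]
    rw [integral_const_mul, integral_gaussian, div_one, mul_inv, mul_inv, mul_assoc]
    congr 1
    nth_rw 1 [← Real.mul_self_sqrt Real.pi_pos.le]
    field_simp
  have hint' : Integrable (fun x ↦ x * gaussianPDFReal 0 1 x * cdf (gaussianReal 0 1) x) := by
    refine hint.mul_bdd (c := 1) hcm.aestronglyMeasurable (ae_of_all _ fun x ↦ ?_)
    rw [Real.norm_eq_abs, abs_of_nonneg (cdf_nonneg _ _)]
    exact cdf_le_one _ _
  have hlim := tendsto_gaussianPDFReal_std_cocompact
  have hparts : ∫ x, (gaussianPDFReal 0 1 x ^ 2 -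
      x * gaussianPDFReal 0 1 x * cdf (gaussianReal 0 1) x) = 0 := by
    have := integral_of_hasDerivAt_of_tendsto
      (f := fun x ↦ cdf (gaussianReal 0 1) x * gaussianPDFReal 0 1 x)
      (f' := fun x ↦ gaussianPDFReal 0 1 x ^ 2 -
        x * gaussianPDFReal 0 1 x * cdf (gaussianReal 0 1) x) (m := 0 * 0) (n := 1 * 0)
      (fun x ↦ ?_) (hsq.sub hint') ((tendsto_cdf_atBot _).mul (hlim.mono_left atBot_le_cocompact))
      ((tendsto_cdf_atTop _).mul (hlim.mono_left atTop_le_cocompact))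
    · simpa using this
    · convert! (hasDerivAt_cdf_gaussianReal 1 one_ne_zero x).mul (hasDerivAt_gaussianPDFReal_std x)
        using 1
      ring
  rw [integral_sub hsq hint', hsqv] at hparts
  rw [integral_gaussianReal_eq_integral_smul one_ne_zero, eq_of_sub_eq_zero hparts]
  refine integral_congr_ae (ae_of_all _ fun x ↦ ?_)
  simp only [smul_eq_mul]
  ring

lemma abs_inv_sqrt_sub_le (r : ℝ) (hr : r ^ 2 ≤ 1) :
    |(√(2 * Real.pi * (2 - r ^ 2)))⁻¹ * (2 * √Real.pi)⁻¹ - (4 * Real.pi)⁻¹| ≤ r ^ 2 := by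
  have hs : √(2 * Real.pi * (2 - r ^ 2)) = √Real.pi * √(4 - 2 * r ^ 2) := by
    rw [← Real.sqrt_mul Real.pi_pos.le]; ring_nf
  have h1 : √(4 - 2 * r ^ 2) ≤ 2 := Real.sqrt_le_iff.2 ⟨by norm_num, by nlinarith [sq_nonneg r]⟩
  have h2 : 2 - r ^ 2 ≤ √(4 - 2 * r ^ 2) := Real.le_sqrt_of_sq_le (by nlinarith [sq_nonneg r])
  set w := √(4 - 2 * r ^ 2)
  have hw0 : 0 < w := by linarith
  have e : (√Real.pi * w)⁻¹ * (2 * √Real.pi)⁻¹ - (4 * Real.pi)⁻¹ = (2 - w) / (4 * Real.pi * w) := by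
    nth_rw 3 [← Real.mul_self_sqrt Real.pi_pos.le]
    nth_rw 5 [← Real.mul_self_sqrt Real.pi_pos.le]
    have := Real.sqrt_pos.2 Real.pi_pos
    field_simp
    ring
  rw [hs, e, abs_of_nonneg (div_nonneg (by linarith) (by positivity))]
  refine (div_le_self (by linarith) ?_).trans (by linarith)
  nlinarith [Real.pi_gt_three]



/-- For jointly standard Gaussian `X, Y` with correlation `ρ ∈ [-1,1]` (realized as
`X = Z₁`, `Y = ρZ₁ + √(1-ρ²)Z₂` for independent standard Gaussians), with `Φ` the
standard normal CDF: `|E[Φ(X)Φ(Y)] - 1/4 - ρ/(4π)| ≤ C|ρ|³` for an absolute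
constant `C > 0`. -/
theorem expectation_Phi_mul_Phi_estimate :
    ∃ C : ℝ, 0 < C ∧
      ∀ (Ω : Type) (_ : MeasureSpace Ω) (_ : IsProbabilityMeasure (ℙ : Measure Ω))
        (Z₁ Z₂ : Ω → ℝ), Measurable Z₁ → Measurable Z₂ →
        IndepFun Z₁ Z₂ ℙ →
        Measure.map Z₁ ℙ = gaussianReal 0 1 →
        Measure.map Z₂ ℙ = gaussianReal 0 1 →
        ∀ ρ : ℝ, ρ ∈ Set.Icc (-1 : ℝ) 1 →
        ∀ X Y : Ω → ℝ, X = Z₁ →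
        Y = (fun ω => ρ * Z₁ ω + Real.sqrt (1 - ρ ^ 2) * Z₂ ω) →
        |(∫ ω, cdf (gaussianReal 0 1) (X ω) * cdf (gaussianReal 0 1) (Y ω))
            - 1 / 4 - ρ / (4 * Real.pi)| ≤ C * |ρ| ^ 3 := by
  set K : ℝ := ∫ x, |x| ^ 3 ∂gaussianReal 0 1 with hK
  have hK0 : 0 ≤ K := integral_nonneg fun x ↦ by positivity
  refine ⟨K + 1, by positivity, ?_⟩
  rintro Ω _ _ Z₁ Z₂ hZ₁ hZ₂ hind hlaw₁ hlaw₂ ρ ⟨hρ₁, hρ₂⟩ X Y rfl rfl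
  have hρ : ρ ^ 2 ≤ 1 := by nlinarith
  set s := √(1 - ρ ^ 2)
  have hs : s ^ 2 = 1 - ρ ^ 2 := Real.sq_sqrt (by linarith)
  let v : ℝ≥0 := ⟨s ^ 2 + 1, by positivity⟩
  have hv : (v : ℝ) = s ^ 2 + 1 := rfl
  have hv1 : 1 ≤ v := by
    rw [← NNReal.coe_le_coe, hv, NNReal.coe_one]
    nlinarith [sq_nonneg s]
  set γ := gaussianReal 0 1
  have hcm : Measurable (cdf γ) := (monotone_cdf _).measurable
  have hcb : ∀ x, ‖cdf γ x‖ ≤ 1 := fun x ↦ by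
    rw [Real.norm_eq_abs, abs_of_nonneg (cdf_nonneg _ _)]
    exact cdf_le_one _ _
  have hvm : Measurable (cdf (gaussianReal 0 v)) := (monotone_cdf _).measurable
  have hvb : ∀ x, ‖cdf (gaussianReal 0 v) x‖ ≤ 1 := fun x ↦ by
    rw [Real.norm_eq_abs, abs_of_nonneg (cdf_nonneg _ _)]
    exact cdf_le_one _ _
  have hjoint : Measure.map (fun ω ↦ (X ω, Z₂ ω)) ℙ = γ.prod γ := by
    rw [(indepFun_iff_map_prod_eq_prod_map_map hZ₁.aemeasurable hZ₂.aemeasurable).1 hind,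
      hlaw₁, hlaw₂]
  have hgm : Measurable fun p : ℝ × ℝ ↦ cdf γ p.1 * cdf γ (ρ * p.1 + s * p.2) :=
    (hcm.comp measurable_fst).mul (hcm.comp (by fun_prop))
  have hE : ∫ ω, cdf γ (X ω) * cdf γ (ρ * X ω + s * Z₂ ω) =
      ∫ x, cdf γ x * cdf (gaussianReal 0 v) (ρ * x) ∂γ := by
    have h := integral_map (μ := ℙ) (hZ₁.prodMk hZ₂).aemeasurable
      (f := fun p : ℝ × ℝ ↦ cdf γ p.1 * cdf γ (ρ * p.1 + s * p.2)) hgm.aestronglyMeasurable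
    rw [hjoint, integral_prod] at h
    · rw [← h]
      refine integral_congr_ae (ae_of_all _ fun x ↦ ?_)
      simp only
      rw [integral_const_mul, integral_cdf_gaussianReal_comp_affine s _ hv]
    · refine Integrable.of_bound hgm.aestronglyMeasurable 1 (ae_of_all _ fun p ↦ ?_)
      rw [norm_mul]
      exact mul_le_one₀ (hcb _) (norm_nonneg _) (hcb _)
  have hhalf : ∫ x, cdf γ x ∂γ = 1 / 2 := by
    have := integral_cdf_gaussianReal_comp_affine 1 0 (v := 2) (by norm_num)
    simpa [cdf_gaussianReal_zero] using this
  set c := (√(2 * Real.pi * v))⁻¹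
  have hi1 : Integrable (fun x ↦ cdf γ x) γ :=
    Integrable.of_bound hcm.aestronglyMeasurable 1 (ae_of_all _ hcb)
  have hid : Integrable (fun x : ℝ ↦ x) γ :=
    memLp_one_iff_integrable.1 (memLp_id_gaussianReal' 1 (by simp))
  have hi2 : Integrable (fun x ↦ x * cdf γ x) γ :=
    hid.mul_bdd (c := 1) hcm.aestronglyMeasurable (ae_of_all _ hcb)
  have hi3 : Integrable (fun x : ℝ ↦ |x| ^ 3) γ := by
    simpa using (memLp_id_gaussianReal (μ := 0) (v := 1) 3).integrable_norm_pow (by norm_num)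
  have hi4 : Integrable (fun x ↦ cdf γ x * cdf (gaussianReal 0 v) (ρ * x)) γ :=
    hi1.mul_bdd (c := 1) (hvm.comp (by fun_prop)).aestronglyMeasurable
      (ae_of_all _ fun x ↦ hvb _)
  have hi5 : Integrable (fun x ↦ cdf γ x * cdf (gaussianReal 0 v) (ρ * x) - 1 / 2 * cdf γ x) γ :=
    hi4.sub (hi1.const_mul _)
  have hrem : |∫ x, cdf γ x * cdf (gaussianReal 0 v) (ρ * x) ∂γ
      - 1 / 4 - ρ * c * (2 * √Real.pi)⁻¹| ≤ |ρ| ^ 3 * K := by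
    have heq : (∫ x, cdf γ x * cdf (gaussianReal 0 v) (ρ * x) ∂γ)
        - 1 / 4 - ρ * c * (2 * √Real.pi)⁻¹ =
        ∫ x, (cdf γ x * cdf (gaussianReal 0 v) (ρ * x) - 1 / 2 * cdf γ x
          - ρ * c * (x * cdf γ x)) ∂γ := by
      rw [integral_sub hi5 (hi2.const_mul _),
        integral_sub hi4 (hi1.const_mul _), integral_const_mul, integral_const_mul, hhalf,
        integral_mul_cdf_gaussianReal]
      ring
    rw [heq, ← Real.norm_eq_abs, hK, ← integral_const_mul]
    refine norm_integral_le_of_norm_le (hi3.const_mul _) (ae_of_all _ fun x ↦ ?_)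
    rw [show cdf γ x * cdf (gaussianReal 0 v) (ρ * x) - 1 / 2 * cdf γ x - ρ * c * (x * cdf γ x) =
      cdf γ x * (cdf (gaussianReal 0 v) (ρ * x) - 1 / 2 - ρ * x * c) by ring, norm_mul,
      ← mul_pow, ← abs_mul]
    exact (mul_le_of_le_one_left (norm_nonneg _) (hcb x)).trans
      (abs_cdf_gaussianReal_sub_le v hv1 (ρ * x))
  have hlin : |ρ * c * (2 * √Real.pi)⁻¹ - ρ / (4 * Real.pi)| ≤ |ρ| ^ 3 := by
    have h := abs_inv_sqrt_sub_le ρ hρ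
    rw [show (2 : ℝ) - ρ ^ 2 = v by rw [hv, hs]; ring] at h
    rw [show ρ * c * (2 * √Real.pi)⁻¹ - ρ / (4 * Real.pi) =
      ρ * (c * (2 * √Real.pi)⁻¹ - (4 * Real.pi)⁻¹) by ring, abs_mul, pow_succ', sq_abs]
    exact mul_le_mul_of_nonneg_left h (abs_nonneg _)
  rw [hE]
  rw [abs_le] at *
  constructor <;> linarith
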